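/- Let A be a finite-dimensional K-algebra, E a finite-dimensional A-module that is a generator, and Γ = End_A(E)^op. Then Q = D E is an injective Γ-module, there exists a Q-special cotilting Γ-module (unique up to add-equivalence, so there is a unique basic Q-special cotilting module C^Q), and End_Γ(Q)^op ≅ A. -/

import Mathlib

/- Preliminary notions: `add`, `gen`, `cogen`, generators and cogenerators,
short exact sequences, basic modules, indecomposability. -/

noncomputable section

namespace GenFinitePaper

open Function

variable (R : Type) [Ring R]

/-- `M` lies in `add X`, i.e. `M` is a direct summand of a finite direct sum of copies of `X`. -/
def InAdd (X : Type) [AddCommGroup X] [Module R X]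
    (M : Type) [AddCommGroup M] [Module R M] : Prop :=
  ∃ (n : ℕ) (i : M →ₗ[R] (Fin n → X)) (p : (Fin n → X) →ₗ[R] M), p.comp i = LinearMap.id

/-- `M` lies in `gen X`, i.e. `M` is an epimorphic image of a module in `add X`. -/
def InGen (X : Type) [AddCommGroup X] [Module R X]
    (M : Type) [AddCommGroup M] [Module R M] : Prop :=
  ∃ (n : ℕ) (p : (Fin n → X) →ₗ[R] M), Surjective p

/-- `M` lies in `cogen X`, i.e. `M` embeds into a module in `add X`. -/
def InCogen (X : Type) [AddCommGroup X] [Module R X]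
    (M : Type) [AddCommGroup M] [Module R M] : Prop :=
  ∃ (n : ℕ) (i : M →ₗ[R] (Fin n → X)), Injective i

/-- `E` is a generator for `mod R`: `R ∈ add E`. -/
def IsGenerator (E : Type) [AddCommGroup E] [Module R E] : Prop :=
  InAdd R E R

/-- `E` is a cogenerator for `mod R`: every finitely generated (equivalently, over a
finite-dimensional algebra, finite-dimensional) module embeds into a module in `add E`. -/
def IsCogenerator (E : Type) [AddCommGroup E] [Module R E] : Prop :=
  ∀ (M : Type) [AddCommGroup M] [Module R M], Module.Finite R M → InCogen R E M

/-- A short exact sequence `0 → X → Y → Z → 0` of modules, given by a pair of composable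
linear maps. -/
def IsShortExact {X Y Z : Type} [AddCommGroup X] [Module R X] [AddCommGroup Y] [Module R Y]
    [AddCommGroup Z] [Module R Z] (f : X →ₗ[R] Y) (g : Y →ₗ[R] Z) : Prop :=
  Injective f ∧ Surjective g ∧ Exact f g

/-- A module is basic if it has no repeated indecomposable direct summands; equivalently
(by Krull--Remak--Schmidt) no nonzero module `X` is such that `X ⊕ X` is a direct summand. -/
def IsBasic (M : Type) [AddCommGroup M] [Module R M] : Prop :=
  ∀ (X Y : Type) [AddCommGroup X] [Module R X] [AddCommGroup Y] [Module R Y],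
    Nonempty (M ≃ₗ[R] ((X × X) × Y)) → Subsingleton X

/-- A module is indecomposable if it is nonzero and admits no nontrivial idempotent
endomorphism. -/
def Indecomposable (M : Type) [AddCommGroup M] [Module R M] : Prop :=
  Nontrivial M ∧ ∀ φ : M →ₗ[R] M, φ.comp φ = φ → φ = 0 ∨ φ = LinearMap.id

end GenFinitePaper
/- K-linear duality: the dual of the regular module, duals of modules over endomorphism
rings, and Hom-modules over endomorphism rings. -/

namespace GenFinitePaper

open Function

variable (K : Type) [Field K]

/-- `D R = Hom_K(R, K)`, the `K`-linear dual of a `K`-algebra `R`, viewed as a left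
`R`-module via `(r • f) x = f (x * r)`. -/
def RegularDual (R : Type) [Ring R] [Algebra K R] : Type := R →ₗ[K] K

namespace RegularDual

variable (R : Type) [Ring R] [Algebra K R]

instance : AddCommGroup (RegularDual K R) := inferInstanceAs (AddCommGroup (R →ₗ[K] K))

instance : Module K (RegularDual K R) := inferInstanceAs (Module K (R →ₗ[K] K))

/-- The action of `R` on its `K`-linear dual, by `(r • f) x = f (x * r)`. -/
def actHom : R →+* Module.End K (R →ₗ[K] K) where
  toFun r := (LinearMap.mulRight K r).lcomp K K
  map_one' := by ext f x; simp
  map_mul' r s := by ext f x; simp [mul_assoc]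
  map_zero' := by ext f x; simp
  map_add' r s := by ext f x; simp [mul_add]

instance : Module R (RegularDual K R) :=
  Module.compHom (R →ₗ[K] K) (actHom K R)

lemma smul_def (r : R) (f : RegularDual K R) :
    r • f = (f : R →ₗ[K] K).comp (LinearMap.mulRight K r) := rfl

end RegularDual

/-- `D M = Hom_K(M, K)`, the `K`-linear dual of a module `M` over a `K`-algebra `R`,
viewed as a left module over `End_R(M)ᵒᵖ` via `(φᵒᵖ • f) = f ∘ φ`. -/
def ModuleDual (R : Type) [Ring R] [Algebra K R] (M : Type) [AddCommGroup M] [Module R M]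
    [Module K M] [IsScalarTower K R M] : Type := M →ₗ[K] K

namespace ModuleDual

variable (R : Type) [Ring R] [Algebra K R] (M : Type) [AddCommGroup M] [Module R M]
  [Module K M] [IsScalarTower K R M]

instance : AddCommGroup (ModuleDual K R M) := inferInstanceAs (AddCommGroup (M →ₗ[K] K))

instance : Module K (ModuleDual K R M) := inferInstanceAs (Module K (M →ₗ[K] K))

/-- The action of `End_R(M)ᵒᵖ` on `Hom_K(M, K)` by precomposition. -/
def actHom : (Module.End R M)ᵐᵒᵖ →+* Module.End K (M →ₗ[K] K) where
  toFun φ := (LinearMap.restrictScalars K φ.unop).lcomp K K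
  map_one' := by ext f x; rfl
  map_mul' φ ψ := by ext f x; rfl
  map_zero' := by ext f x; simp
  map_add' φ ψ := by ext f x; simp

instance : Module (Module.End R M)ᵐᵒᵖ (ModuleDual K R M) :=
  Module.compHom (M →ₗ[K] K) (actHom K R M)

lemma smul_def (φ : (Module.End R M)ᵐᵒᵖ) (f : ModuleDual K R M) :
    φ • f = (f : M →ₗ[K] K).comp (LinearMap.restrictScalars K φ.unop) := rfl

end ModuleDual

/-- `Hom_R(E, N)` viewed as a left module over `Γ = End_R(E)ᵒᵖ` via `(φᵒᵖ • g) = g ∘ φ`. -/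
def HomOp (R : Type) [Ring R] (E : Type) [AddCommGroup E] [Module R E]
    (N : Type) [AddCommGroup N] [Module R N] : Type := E →ₗ[R] N

namespace HomOp

variable (R : Type) [Ring R] (E : Type) [AddCommGroup E] [Module R E]
  (N : Type) [AddCommGroup N] [Module R N]

instance : AddCommGroup (HomOp R E N) := inferInstanceAs (AddCommGroup (E →ₗ[R] N))

/-- The action of `End_R(E)ᵒᵖ` on `Hom_R(E, N)` by precomposition. -/
def actHom : (Module.End R E)ᵐᵒᵖ →+* Module.End ℤ (E →ₗ[R] N) where
  toFun φ :=
    { toFun := fun g => (g : E →ₗ[R] N).comp φ.unop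
      map_add' := fun g h => LinearMap.add_comp _ _ _
      map_smul' := fun n g => LinearMap.smul_comp n g φ.unop }
  map_one' := by ext g x; rfl
  map_mul' φ ψ := by ext g x; rfl
  map_zero' := by ext g x; simp
  map_add' φ ψ := by ext g x; simp

instance : Module (Module.End R E)ᵐᵒᵖ (HomOp R E N) :=
  Module.compHom (E →ₗ[R] N) (actHom R E N)

lemma smul_def (φ : (Module.End R E)ᵐᵒᵖ) (g : HomOp R E N) :
    φ • g = (g : E →ₗ[R] N).comp φ.unop := rfl

end HomOp

end GenFinitePaper
/- Tilting and cotilting modules, and special (co)tilting modules. -/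

namespace GenFinitePaper

open Function

variable (Γ : Type) [Ring Γ]

/-- A (classical) tilting module:
(T1) projective dimension at most 1;
(T2) no self-extensions (every short exact sequence `0 → T → X → T → 0` splits);
(T3) an exact sequence `0 → Γ → T₀ → T₁ → 0` with `T₀, T₁ ∈ add T`. -/
structure IsTilting (T : Type) [AddCommGroup T] [Module Γ T] : Prop where
  pdim_le_one : ∃ (P₁ P₀ : Type) (_ : AddCommGroup P₁) (_ : Module Γ P₁)
      (_ : AddCommGroup P₀) (_ : Module Γ P₀) (f : P₁ →ₗ[Γ] P₀) (g : P₀ →ₗ[Γ] T),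
      Module.Projective Γ P₁ ∧ Module.Projective Γ P₀ ∧ IsShortExact Γ f g
  rigid : ∀ (X : Type) [AddCommGroup X] [Module Γ X], ∀ (f : T →ₗ[Γ] X) (g : X →ₗ[Γ] T),
      IsShortExact Γ f g → ∃ r : X →ₗ[Γ] T, r.comp f = LinearMap.id
  coresolves : ∃ (T₀ T₁ : Type) (_ : AddCommGroup T₀) (_ : Module Γ T₀)
      (_ : AddCommGroup T₁) (_ : Module Γ T₁) (f : Γ →ₗ[Γ] T₀) (g : T₀ →ₗ[Γ] T₁),
      InAdd Γ T T₀ ∧ InAdd Γ T T₁ ∧ IsShortExact Γ f g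

/-- A `P`-special tilting module, for `P` a projective module: a tilting module `T` with
`P ∈ add T` such that the module `T₀` in (T3) can be chosen in `add P`. -/
structure IsSpecialTilting (P : Type) [AddCommGroup P] [Module Γ P]
    (T : Type) [AddCommGroup T] [Module Γ T] : Prop where
  isTilting : IsTilting Γ T
  mem_add : InAdd Γ T P
  coresolves_special : ∃ (T₀ T₁ : Type) (_ : AddCommGroup T₀) (_ : Module Γ T₀)
      (_ : AddCommGroup T₁) (_ : Module Γ T₁) (f : Γ →ₗ[Γ] T₀) (g : T₀ →ₗ[Γ] T₁),
      InAdd Γ P T₀ ∧ InAdd Γ T T₁ ∧ IsShortExact Γ f g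

variable (K : Type) [Field K] [Algebra K Γ]

/-- A (classical) cotilting module:
(C1) injective dimension at most 1;
(C2) no self-extensions;
(C3) an exact sequence `0 → C1 → C0 → DΓ → 0` with `C0, C1 ∈ add C`,
where `DΓ` is the `K`-linear dual of the regular module. -/
structure IsCotilting (C : Type) [AddCommGroup C] [Module Γ C] : Prop where
  idim_le_one : ∃ (I0 I1 : Type) (_ : AddCommGroup I0) (_ : Module Γ I0)
      (_ : AddCommGroup I1) (_ : Module Γ I1) (f : C →ₗ[Γ] I0) (g : I0 →ₗ[Γ] I1),
      Module.Injective Γ I0 ∧ Module.Injective Γ I1 ∧ IsShortExact Γ f g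
  rigid : ∀ (X : Type) [AddCommGroup X] [Module Γ X], ∀ (f : C →ₗ[Γ] X) (g : X →ₗ[Γ] C),
      IsShortExact Γ f g → ∃ r : X →ₗ[Γ] C, r.comp f = LinearMap.id
  resolves : ∃ (C1 C0 : Type) (_ : AddCommGroup C1) (_ : Module Γ C1)
      (_ : AddCommGroup C0) (_ : Module Γ C0) (f : C1 →ₗ[Γ] C0)
      (g : C0 →ₗ[Γ] RegularDual K Γ),
      InAdd Γ C C1 ∧ InAdd Γ C C0 ∧ IsShortExact Γ f g

/-- A `Q`-special cotilting module, for `Q` an injective module: a cotilting module `C` with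
`Q ∈ add C` such that the module `C0` in (C3) can be chosen in `add Q`. -/
structure IsSpecialCotilting (Q : Type) [AddCommGroup Q] [Module Γ Q]
    (C : Type) [AddCommGroup C] [Module Γ C] : Prop where
  isCotilting : IsCotilting Γ K C
  mem_add : InAdd Γ C Q
  resolves_special : ∃ (C1 C0 : Type) (_ : AddCommGroup C1) (_ : Module Γ C1)
      (_ : AddCommGroup C0) (_ : Module Γ C0) (f : C1 →ₗ[Γ] C0)
      (g : C0 →ₗ[Γ] RegularDual K Γ),
      InAdd Γ Q C0 ∧ InAdd Γ C C1 ∧ IsShortExact Γ f g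

end GenFinitePaper

namespace GenFinitePaper

open Function

section Exactness

variable {R : Type} [Ring R] {A B X Y : Type}
  [AddCommGroup A] [Module R A] [AddCommGroup B] [Module R B]
  [AddCommGroup X] [Module R X] [AddCommGroup Y] [Module R Y]
  {f : A →ₗ[R] B} {g : B →ₗ[R] X}

/-- A map out of the middle term of a short exact sequence which kills the left term descends
to the right term. -/
lemma IsShortExact.desc (H : IsShortExact R f g) (h : B →ₗ[R] Y) (w : ∀ a, h (f a) = 0) :
    ∃ k : X →ₗ[R] Y, ∀ b, k (g b) = h b := by
  obtain ⟨-, hg, hfg⟩ := H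
  let e := g.quotKerEquivOfSurjective hg
  refine ⟨((LinearMap.ker g).liftQ h ?_).comp e.symm.toLinearMap, fun b => ?_⟩
  · intro b hb
    obtain ⟨a, rfl⟩ := (hfg b).1 hb
    exact w a
  · have : e.symm (g b) = (LinearMap.ker g).mkQ b := by
      rw [LinearEquiv.symm_apply_eq]; rfl
    simp [this]

/-- A map into the middle term of a short exact sequence which dies in the right term factors
through the left term. -/
lemma IsShortExact.lift (H : IsShortExact R f g) (h : Y →ₗ[R] B) (w : ∀ y, g (h y) = 0) :
    ∃ k : Y →ₗ[R] A, ∀ y, f (k y) = h y := by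
  obtain ⟨hf, -, hfg⟩ := H
  let e := LinearEquiv.ofInjective f hf
  refine ⟨e.symm.toLinearMap.comp (h.codRestrict (LinearMap.range f)
    fun y => (hfg (h y)).1 (w y)), fun y => ?_⟩
  have := e.apply_symm_apply ⟨h y, (hfg (h y)).1 (w y)⟩
  exact congrArg Subtype.val this

/-- The quotient of a module by the range of an injective map. -/
lemma isShortExact_mkQ_range (hf : Injective f) :
    IsShortExact R f (LinearMap.range f).mkQ :=
  ⟨hf, Submodule.mkQ_surjective _, LinearMap.exact_map_mkQ_range f⟩

/-- The kernel of a surjective map. -/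
lemma isShortExact_ker_subtype (hg : Surjective g) :
    IsShortExact R (LinearMap.ker g).subtype g :=
  ⟨Submodule.subtype_injective _, hg, LinearMap.exact_subtype_ker_map g⟩

/-- The pushout of a short exact sequence along a map out of its left term. -/
lemma IsShortExact.pushout (H : IsShortExact R f g) (h : A →ₗ[R] Y) :
    ∃ (Z : Type) (_ : AddCommGroup Z) (_ : Module R Z) (u : Y →ₗ[R] Z) (v : Z →ₗ[R] X)
      (t : B →ₗ[R] Z), IsShortExact R u v ∧ ∀ a, t (f a) = u (h a) := by
  obtain ⟨hf, hg, hfg⟩ := H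
  let N : Submodule R (Y × B) := LinearMap.range (h.prod (-f))
  have hN : N ≤ LinearMap.ker (g.comp (LinearMap.snd R Y B)) := by
    rintro _ ⟨a, rfl⟩
    simp [hfg.apply_apply_eq_zero]
  refine ⟨(Y × B) ⧸ N, inferInstance, inferInstance, N.mkQ.comp (LinearMap.inl R Y B),
    N.liftQ _ hN, N.mkQ.comp (LinearMap.inr R Y B), ⟨?_, ?_, ?_⟩, ?_⟩
  · rw [injective_iff_map_eq_zero]
    intro y hy
    obtain ⟨a, ha⟩ := (Submodule.Quotient.mk_eq_zero N).1 hy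
    have h1 : h a = y := congrArg Prod.fst ha
    have h2 : -f a = 0 := congrArg Prod.snd ha
    have : a = 0 := hf (by simpa using h2)
    rw [← h1, this, map_zero]
  · intro x
    obtain ⟨b, rfl⟩ := hg x
    exact ⟨N.mkQ (0, b), by simp⟩
  · intro z
    obtain ⟨⟨y, b⟩, rfl⟩ := N.mkQ_surjective z
    constructor
    · intro hz
      obtain ⟨a, rfl⟩ := (hfg b).1 (by simpa using hz)
      refine ⟨y + h a, ?_⟩
      rw [← sub_eq_zero, LinearMap.comp_apply, ← map_sub]
      refine (Submodule.Quotient.mk_eq_zero N).2 ⟨a, ?_⟩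
      simp
    · rintro ⟨y', hy'⟩
      rw [← hy']
      simp
  · intro a
    rw [← sub_eq_zero, LinearMap.comp_apply, LinearMap.comp_apply, ← map_sub]
    refine (Submodule.Quotient.mk_eq_zero N).2 ⟨-a, ?_⟩
    simp

/-- The pullback of a short exact sequence along a map into its right term. -/
lemma IsShortExact.pullback (H : IsShortExact R f g) (h : Y →ₗ[R] X) :
    ∃ (Z : Type) (_ : AddCommGroup Z) (_ : Module R Z) (u : A →ₗ[R] Z) (v : Z →ₗ[R] Y)
      (t : Z →ₗ[R] B), IsShortExact R u v ∧ (∀ a, t (u a) = f a) ∧ ∀ z, g (t z) = h (v z) := by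
  obtain ⟨hf, hg, hfg⟩ := H
  let P : Submodule R (B × Y) :=
    LinearMap.ker (g.comp (LinearMap.fst R B Y) - h.comp (LinearMap.snd R B Y))
  have hP : ∀ z : P, g z.1.1 = h z.1.2 := fun z => sub_eq_zero.1 z.2
  refine ⟨P, inferInstance, inferInstance,
    ((LinearMap.inl R B Y).comp f).codRestrict P ?_, (LinearMap.snd R B Y).comp P.subtype,
    (LinearMap.fst R B Y).comp P.subtype, ⟨?_, ?_, ?_⟩, ?_, ?_⟩
  · intro a
    simp [P, hfg.apply_apply_eq_zero]
  · intro a a' haa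
    exact hf (congrArg (fun z : P => z.1.1) haa)
  · intro y
    obtain ⟨b, hb⟩ := hg (h y)
    exact ⟨⟨(b, y), by simp [P, hb]⟩, rfl⟩
  · intro z
    constructor
    · intro hz
      have hz2 : z.1.2 = 0 := hz
      obtain ⟨a, ha⟩ := (hfg z.1.1).1 (by rw [hP z, hz2, map_zero])
      exact ⟨a, Subtype.ext (Prod.ext ha hz2.symm)⟩
    · rintro ⟨a, rfl⟩
      rfl
  · intro a
    rfl
  · exact hP

end Exactness

section Add

variable {R : Type} [Ring R] {X M N : Type}
  [AddCommGroup X] [Module R X] [AddCommGroup M] [Module R M] [AddCommGroup N] [Module R N]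

lemma InAdd.of_retract_pi {ι : Type} [Finite ι] (i : M →ₗ[R] (ι → X)) (p : (ι → X) →ₗ[R] M)
    (h : ∀ m, p (i m) = m) : InAdd R X M := by
  obtain ⟨n, ⟨e⟩⟩ := Finite.exists_equiv_fin ι
  let E : (ι → X) ≃ₗ[R] (Fin n → X) := LinearEquiv.funCongrLeft R X e.symm
  exact ⟨n, E.toLinearMap.comp i, p.comp E.symm.toLinearMap, by ext m; simp [h]⟩

lemma InAdd.of_retract (i : M →ₗ[R] X) (p : X →ₗ[R] M) (h : ∀ m, p (i m) = m) :
    InAdd R X M :=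
  .of_retract_pi (ι := Unit) (LinearMap.pi fun _ => i) (p.comp (LinearMap.proj ()))
    fun m => h m

lemma InAdd.refl : InAdd R X X := .of_retract LinearMap.id LinearMap.id fun _ => rfl

lemma InAdd.retract (hM : InAdd R X M) (i : N →ₗ[R] M) (p : M →ₗ[R] N) (h : ∀ m, p (i m) = m) :
    InAdd R X N := by
  obtain ⟨n, j, q, hq⟩ := hM
  refine ⟨n, j.comp i, p.comp q, ?_⟩
  ext x
  have : q (j (i x)) = i x := LinearMap.congr_fun hq (i x)
  simp [this, h]

lemma InAdd.pi {ι : Type} [Finite ι] (hM : InAdd R X M) : InAdd R X (ι → M) := by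
  obtain ⟨n, j, q, hq⟩ := hM
  let e := LinearEquiv.curry R X ι (Fin n)
  refine .of_retract_pi (ι := ι × Fin n)
    (e.symm.toLinearMap.comp (LinearMap.pi fun k => j.comp (LinearMap.proj k)))
    ((LinearMap.pi fun k => q.comp (LinearMap.proj k)).comp e.toLinearMap) fun m => ?_
  ext k
  simpa using LinearMap.congr_fun hq (m k)

lemma InAdd.trans (hM : InAdd R X M) (hN : InAdd R M N) : InAdd R X N := by
  obtain ⟨n, j, q, hq⟩ := hN
  exact (hM.pi (ι := Fin n)).retract j q (LinearMap.congr_fun hq)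

lemma InAdd.prod (hM : InAdd R X M) (hN : InAdd R X N) : InAdd R X (M × N) := by
  obtain ⟨n, i, p, hp⟩ := hM
  obtain ⟨m, j, q, hq⟩ := hN
  let e := LinearEquiv.sumArrowLequivProdArrow (Fin n) (Fin m) R X
  refine .of_retract_pi (ι := Fin n ⊕ Fin m) (e.symm.toLinearMap.comp (i.prodMap j))
    ((p.prodMap q).comp e.toLinearMap) fun x => ?_
  have h1 : p (i x.1) = x.1 := LinearMap.congr_fun hp x.1
  have h2 : q (j x.2) = x.2 := LinearMap.congr_fun hq x.2
  ext <;> simp [h1, h2]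

/-- A retract is a direct factor. -/
def prodKerEquiv (i : M →ₗ[R] X) (p : X →ₗ[R] M) (h : ∀ m, p (i m) = m) :
    X ≃ₗ[R] M × LinearMap.ker p where
  toFun x := (p x, ⟨x - i (p x), by simp [h]⟩)
  map_add' x y := by ext <;> simp; abel
  map_smul' r x := by ext <;> simp [smul_sub]
  invFun z := i z.1 + z.2
  left_inv x := by simp
  right_inv z := by ext <;> simp [h]

end Add

end GenFinitePaper

namespace GenFinitePaper

open Function

section Ext

variable (R : Type) [Ring R]

/-- The vanishing of `Ext¹_R(X, Y)`: every map `A → Y` extends along every injection `A → B`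
with cokernel `X`. -/
def ExtVanishes (X Y : Type) [AddCommGroup X] [Module R X] [AddCommGroup Y] [Module R Y] : Prop :=
  ∀ (A B : Type) [AddCommGroup A] [Module R A] [AddCommGroup B] [Module R B]
    (f : A →ₗ[R] B) (g : B →ₗ[R] X), IsShortExact R f g →
      ∀ h : A →ₗ[R] Y, ∃ k : B →ₗ[R] Y, ∀ a, k (f a) = h a

variable {R}

/-- Every map `X → B'` lifts along `g : B → B'`. -/
def Lifts (X : Type) [AddCommGroup X] [Module R X] {B B' : Type} [AddCommGroup B] [Module R B]
    [AddCommGroup B'] [Module R B'] (g : B →ₗ[R] B') : Prop :=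
  ∀ h : X →ₗ[R] B', ∃ k : X →ₗ[R] B, ∀ x, g (k x) = h x

variable {A B B' X X' Y Y' Z I₀ I₁ : Type}
  [AddCommGroup A] [Module R A] [AddCommGroup B] [Module R B] [AddCommGroup B'] [Module R B']
  [AddCommGroup X] [Module R X] [AddCommGroup X'] [Module R X']
  [AddCommGroup Y] [Module R Y] [AddCommGroup Y'] [Module R Y'] [AddCommGroup Z] [Module R Z]
  [AddCommGroup I₀] [Module R I₀] [AddCommGroup I₁] [Module R I₁]

lemma Lifts.add {g : B →ₗ[R] B'} (H : Lifts X g) (hX : InAdd R X X') : Lifts X' g := by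
  obtain ⟨n, i, p, hp⟩ := hX
  intro h
  choose k hk using fun j => H ((h.comp p).comp (LinearMap.single R (fun _ : Fin n => X) j))
  refine ⟨(LinearMap.lsum R (fun _ => X) ℕ k).comp i, fun x => ?_⟩
  have hx : p (i x) = x := LinearMap.congr_fun hp x
  have : g.comp (LinearMap.lsum R (fun _ => X) ℕ k) = h.comp p :=
    LinearMap.pi_ext' fun j => by
      ext x
      simpa [LinearMap.lsum_piSingle, -LinearMap.lsum_apply] using hk j x
  simpa [hx] using LinearMap.congr_fun this (i x)

/-- Lifting to a power of an epimorphism, one coordinate at a time. -/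
lemma Lifts.pi {g : B →ₗ[R] B'} (H : Lifts X g) {n : ℕ} (h : X →ₗ[R] (Fin n → B')) :
    ∃ k : X →ₗ[R] (Fin n → B), ∀ x j, g (k x j) = h x j := by
  choose k hk using fun j => H ((LinearMap.proj j).comp h)
  exact ⟨LinearMap.pi k, fun x j => hk j x⟩

lemma ExtVanishes.add_right (H : ExtVanishes R X Y) (hY : InAdd R Y Y') : ExtVanishes R X Y' := by
  obtain ⟨n, i, p, hp⟩ := hY
  intro A B _ _ _ _ f g hfg h
  choose k hk using fun j => H A B f g hfg ((LinearMap.proj j).comp (i.comp h))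
  refine ⟨p.comp (LinearMap.pi k), fun a => ?_⟩
  have : LinearMap.pi k (f a) = i (h a) := by ext j; exact hk j a
  rw [LinearMap.comp_apply, this]
  exact LinearMap.congr_fun hp (h a)

lemma ExtVanishes.of_splits
    (H : ∀ (Z : Type) [AddCommGroup Z] [Module R Z] (u : Y →ₗ[R] Z) (v : Z →ₗ[R] X),
      IsShortExact R u v → ∃ r : Z →ₗ[R] Y, r.comp u = LinearMap.id) : ExtVanishes R X Y := by
  intro A B _ _ _ _ f g hfg h
  obtain ⟨Z, _, _, u, v, t, huv, ht⟩ := hfg.pushout h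
  obtain ⟨r, hr⟩ := H Z u v huv
  refine ⟨r.comp t, fun a => ?_⟩
  rw [LinearMap.comp_apply, ht]
  exact LinearMap.congr_fun hr (h a)

lemma ExtVanishes.splits (H : ExtVanishes R X Y) {u : Y →ₗ[R] Z} {v : Z →ₗ[R] X}
    (h : IsShortExact R u v) : ∃ r : Z →ₗ[R] Y, r.comp u = LinearMap.id := by
  obtain ⟨r, hr⟩ := H _ _ u v h LinearMap.id
  exact ⟨r, LinearMap.ext hr⟩

lemma ExtVanishes.lifts (H : ExtVanishes R X Y) {u : Y →ₗ[R] Z} {v : Z →ₗ[R] B}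
    (huv : IsShortExact R u v) : Lifts X v := by
  intro h
  obtain ⟨P, _, _, f, g, t, hfg, htf, htg⟩ := huv.pullback h
  obtain ⟨r, hr⟩ := H _ _ f g hfg LinearMap.id
  obtain ⟨k, hk⟩ := hfg.desc (t - u.comp r) fun a => by simp [htf, hr]
  refine ⟨k, fun x => ?_⟩
  obtain ⟨z, rfl⟩ := hfg.2.1 x
  simp [hk, htg, huv.2.2.apply_apply_eq_zero]

/-- If `0 → Y → I₀ → I₁ → 0` is an injective coresolution, `Ext¹(-, Y)` vanishes on all submodules
of a module from which maps to `I₁` lift to `I₀`. -/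
lemma Lifts.extVanishes {f : Y →ₗ[R] I₀} {g : I₀ →ₗ[R] I₁} (hfg : IsShortExact R f g)
    (h₀ : Module.Injective R I₀) (h₁ : Module.Injective R I₁) (H : Lifts X' g)
    (j : X →ₗ[R] X') (hj : Injective j) : ExtVanishes R X Y := by
  intro A B _ _ _ _ a b hab h
  obtain ⟨e, he⟩ := h₀.out a hab.1 (f.comp h)
  obtain ⟨d, hd⟩ := hab.desc (g.comp e) fun x => by simp [he, hfg.2.2.apply_apply_eq_zero]
  obtain ⟨d', hd'⟩ := h₁.out j hj d
  obtain ⟨l, hl⟩ := H d'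
  obtain ⟨k, hk⟩ := hfg.lift (e - l.comp (j.comp b)) fun x => by simp [hl, hd', hd]
  refine ⟨k, fun x => hfg.1 ?_⟩
  simp [hk, he, hab.2.2.apply_apply_eq_zero]

/-- Given a short exact sequence `0 → X → Y → Z → 0`, lifting from `Z` reduces to lifting from
`Y` when maps out of `X` extend to `Y`. -/
lemma Lifts.of_isShortExact {a : X →ₗ[R] Y} {b : Y →ₗ[R] Z} (hab : IsShortExact R a b)
    {f : A →ₗ[R] B} {g : B →ₗ[R] B'} (hfg : IsShortExact R f g)
    (hext : ∀ h : X →ₗ[R] A, ∃ k : Y →ₗ[R] A, ∀ x, k (a x) = h x) (H : Lifts Y g) :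
    Lifts Z g := by
  intro h
  obtain ⟨s, hs⟩ := H (h.comp b)
  obtain ⟨c, hc⟩ := hfg.lift (s.comp a) fun x => by simp [hs, hab.2.2.apply_apply_eq_zero]
  obtain ⟨c', hc'⟩ := hext c
  obtain ⟨k, hk⟩ := hab.desc (s - f.comp c') fun x => by simp [hc', hc]
  refine ⟨k, fun z => ?_⟩
  obtain ⟨y, rfl⟩ := hab.2.1 z
  simp [hk, hs, hfg.2.2.apply_apply_eq_zero]

/-- Injective dimension at most one passes to direct summands. -/
lemma exists_injective_coresolution_of_retract {f : Y →ₗ[R] I₀} {g : I₀ →ₗ[R] I₁}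
    (hfg : IsShortExact R f g) (h₀ : Module.Injective R I₀) (h₁ : Module.Injective R I₁)
    (i : X →ₗ[R] Y) (p : Y →ₗ[R] X) (hp : ∀ x, p (i x) = x) :
    ∃ (V : Type) (_ : AddCommGroup V) (_ : Module R V) (u : X →ₗ[R] I₀) (v : I₀ →ₗ[R] V),
      Module.Injective R V ∧ IsShortExact R u v := by
  let u := f.comp i
  have hu : Injective u := hfg.1.comp (LeftInverse.injective hp)
  let v := (LinearMap.range u).mkQ
  have huv : IsShortExact R u v := isShortExact_mkQ_range hu
  refine ⟨_, _, _, u, v, ⟨fun A B _ _ _ _ j hj h => ?_⟩, huv⟩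
  obtain ⟨q, hq⟩ := huv.desc g fun x => hfg.2.2.apply_apply_eq_zero (i x)
  obtain ⟨P, hP⟩ := h₀.out f hfg.1 (u.comp p)
  obtain ⟨P', hP'⟩ := hfg.desc (v.comp P) fun y => by
    simp [hP, huv.2.2.apply_apply_eq_zero]
  obtain ⟨δ, hδ⟩ := huv.desc (P - LinearMap.id) fun x => by
    simp [u, hP, hp]
  obtain ⟨k, hk⟩ := h₁.out j hj (q.comp h)
  obtain ⟨d, hd⟩ := h₀.out j hj (δ.comp h)
  refine ⟨P'.comp k - v.comp d, fun x => ?_⟩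
  obtain ⟨z, hz⟩ := huv.2.1 (h x)
  simp [hk, hd, ← hz, hq, hP', hδ]

lemma Injective.prod (hX : Module.Injective R X) (hY : Module.Injective R Y) :
    Module.Injective R (X × Y) := by
  refine ⟨fun A B _ _ _ _ j hj h => ?_⟩
  obtain ⟨k, hk⟩ := hX.out j hj ((LinearMap.fst R X Y).comp h)
  obtain ⟨l, hl⟩ := hY.out j hj ((LinearMap.snd R X Y).comp h)
  exact ⟨k.prod l, fun x => Prod.ext (hk x) (hl x)⟩

lemma Injective.pi {ι : Type} (hX : Module.Injective R X) : Module.Injective R (ι → X) := by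
  refine ⟨fun A B _ _ _ _ j hj h => ?_⟩
  choose k hk using fun i => hX.out j hj ((LinearMap.proj i).comp h)
  exact ⟨LinearMap.pi k, fun x => funext fun i => hk i x⟩

lemma Injective.retract (hX : Module.Injective R X) (i : Y →ₗ[R] X) (p : X →ₗ[R] Y)
    (hp : ∀ y, p (i y) = y) : Module.Injective R Y := by
  refine ⟨fun A B _ _ _ _ j hj h => ?_⟩
  obtain ⟨k, hk⟩ := hX.out j hj (i.comp h)
  exact ⟨p.comp k, fun x => by simp [hk, hp]⟩

end Ext

section RegularDual

variable (K : Type) [Field K] (Γ : Type) [Ring Γ] [Algebra K Γ]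

instance : CoeFun (RegularDual K Γ) fun _ => Γ → K := ⟨fun F => ⇑(show Γ →ₗ[K] K from F)⟩

/-- The map `X → DΓ` corresponding to a linear form on `X`. -/
def RegularDual.ofForm {X : Type} [AddCommGroup X] [Module Γ X] [Module K X] [IsScalarTower K Γ X]
    (l : X →ₗ[K] K) : X →ₗ[Γ] RegularDual K Γ where
  toFun x := l.comp ((LinearMap.toSpanSingleton Γ X x).restrictScalars K)
  map_add' x y := by
    refine LinearMap.ext fun r => ?_
    change l (r • (x + y)) = l (r • x) + l (r • y)
    simp
  map_smul' s x := by
    refine LinearMap.ext fun r => ?_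
    change l (r • s • x) = l ((r * s) • x)
    rw [mul_smul]

/-- Evaluation at `1` on `DΓ`, after a map `X → DΓ`. -/
def RegularDual.toForm {X : Type} [AddCommGroup X] [Module Γ X] [Module K X] [IsScalarTower K Γ X]
    (g : X →ₗ[Γ] RegularDual K Γ) : X →ₗ[K] K where
  toFun x := (g x) 1
  map_add' x y := by
    rw [map_add]; rfl
  map_smul' c x := by
    rw [← algebraMap_smul Γ c x, map_smul]
    change (g x) (1 * algebraMap K Γ c) = c • (g x) 1
    rw [one_mul, Algebra.algebraMap_eq_smul_one, map_smul]

lemma RegularDual.apply_eq {X : Type} [AddCommGroup X] [Module Γ X]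
    (g : X →ₗ[Γ] RegularDual K Γ) (x : X) (r : Γ) :
    (g x) r = (g (r • x)) 1 := by
  rw [map_smul]
  change _ = (g x) (1 * r)
  rw [one_mul]

/-- The `K`-structure underlying a module over a `K`-algebra. -/
lemma isScalarTower_compHom (X : Type) [AddCommGroup X] [Module Γ X] :
    letI : Module K X := Module.compHom X (algebraMap K Γ)
    IsScalarTower K Γ X := by
  let _ : Module K X := Module.compHom X (algebraMap K Γ)
  refine ⟨fun c r x => ?_⟩
  change (c • r) • x = algebraMap K Γ c • r • x
  rw [Algebra.smul_def, mul_smul]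

lemma RegularDual.injective : Module.Injective Γ (RegularDual K Γ) := by
  refine ⟨fun X Y _ _ _ _ f hf g => ?_⟩
  let _ : Module K X := Module.compHom X (algebraMap K Γ)
  have := isScalarTower_compHom K Γ X
  let _ : Module K Y := Module.compHom Y (algebraMap K Γ)
  have := isScalarTower_compHom K Γ Y
  obtain ⟨q, hq⟩ := (f.restrictScalars K).exists_leftInverse_of_injective
    (LinearMap.ker_eq_bot.2 hf)
  refine ⟨RegularDual.ofForm K Γ ((RegularDual.toForm K Γ g).comp q), fun x => ?_⟩
  refine LinearMap.ext fun r => ?_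
  rw [RegularDual.apply_eq K Γ g]
  change RegularDual.toForm K Γ g (q (r • f x)) = RegularDual.toForm K Γ g (r • x)
  rw [← map_smul]
  exact congrArg _ (LinearMap.congr_fun hq (r • x))

/-- `DΓ` cogenerates the finitely generated modules. -/
lemma RegularDual.inCogen [FiniteDimensional K Γ]
    (X : Type) [AddCommGroup X] [Module Γ X] [Module.Finite Γ X] :
    InCogen Γ (RegularDual K Γ) X := by
  let _ : Module K X := Module.compHom X (algebraMap K Γ)
  have := isScalarTower_compHom K Γ X
  have : Module.Finite K X := .trans Γ X
  let b := Module.finBasis K X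
  refine ⟨_, LinearMap.pi fun j => RegularDual.ofForm K Γ (b.coord j), ?_⟩
  rw [injective_iff_map_eq_zero]
  intro x hx
  refine b.ext_elem fun j => ?_
  have : b.coord j ((1 : Γ) • x) = 0 :=
    LinearMap.congr_fun (show (_ : Γ →ₗ[K] K) = 0 from congrFun hx j) 1
  simpa using this

/-- Left approximations of finitely generated modules by a finitely generated module. -/
lemma exists_left_approximation (K : Type) [Field K] {Γ : Type} [Ring Γ] [Algebra K Γ]
    [FiniteDimensional K Γ] (X Z : Type) [AddCommGroup X] [Module Γ X] [Module.Finite Γ X]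
    [AddCommGroup Z] [Module Γ Z] [Module.Finite Γ Z] :
    ∃ (n : ℕ) (a : X →ₗ[Γ] (Fin n → Z)),
      ∀ h : X →ₗ[Γ] Z, ∃ k : (Fin n → Z) →ₗ[Γ] Z, ∀ x, k (a x) = h x := by
  let _ : Module K X := Module.compHom X (algebraMap K Γ)
  have := isScalarTower_compHom K Γ X
  have : Module.Finite K X := .trans Γ X
  let _ : Module K Z := Module.compHom Z (algebraMap K Γ)
  have := isScalarTower_compHom K Γ Z
  have : Module.Finite K Z := .trans Γ Z
  have : SMulCommClass Γ K Z := IsScalarTower.to_smulCommClass'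
  have : Module.Finite K (X →ₗ[Γ] Z) :=
    .of_injective (LinearMap.restrictScalarsₗ K Γ X Z K) (LinearMap.restrictScalars_injective K)
  let b := Module.finBasis K (X →ₗ[Γ] Z)
  refine ⟨_, LinearMap.pi b, fun h => ⟨∑ j, b.repr h j • LinearMap.proj j, fun x => ?_⟩⟩
  have hx := LinearMap.congr_fun (b.sum_repr h) x
  rw [LinearMap.sum_apply] at hx
  simpa using hx

end RegularDual

end GenFinitePaper

namespace GenFinitePaper

open Function

section Cotilting

variable {Γ : Type} [Ring Γ] {K : Type} [Field K] [Algebra K Γ]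
  {Q C C' : Type} [AddCommGroup Q] [Module Γ Q] [AddCommGroup C] [Module Γ C]
  [AddCommGroup C'] [Module Γ C']

lemma IsCotilting.extVanishes (H : IsCotilting Γ K C) : ExtVanishes Γ C C :=
  .of_splits fun Z _ _ u v huv => H.rigid Z u v huv

/-- A finitely generated module from which maps to `DΓ` lift along an epimorphism `C₀ → DΓ` embeds
into a power of `C₀`. -/
lemma Lifts.inCogen [FiniteDimensional K Γ] {C₀ X : Type} [AddCommGroup C₀] [Module Γ C₀]
    [AddCommGroup X] [Module Γ X] [Module.Finite Γ X] {g : C₀ →ₗ[Γ] RegularDual K Γ}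
    (H : Lifts X g) : InCogen Γ C₀ X := by
  obtain ⟨n, i, hi⟩ := RegularDual.inCogen K Γ X
  obtain ⟨k, hk⟩ := H.pi i
  refine ⟨n, k, fun x y hxy => hi ?_⟩
  ext j : 1
  rw [← hk, ← hk, hxy]

/-- If `X` embeds into a module in `add C`, then `Ext¹(X, C) = 0`. -/
lemma IsCotilting.extVanishes_of_inCogen (H : IsCotilting Γ K C) {C₀ X : Type} [AddCommGroup C₀]
    [Module Γ C₀] [AddCommGroup X] [Module Γ X] (h₀ : InAdd Γ C C₀) (hX : InCogen Γ C₀ X) :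
    ExtVanishes Γ X C := by
  obtain ⟨I₀, I₁, _, _, _, _, f, g, hI₀, hI₁, hfg⟩ := H.idim_le_one
  obtain ⟨n, i, hi⟩ := hX
  exact ((H.extVanishes.lifts hfg).add (h₀.pi (ι := Fin n))).extVanishes hfg hI₀ hI₁ i hi

/-- Two finitely generated `Q`-special cotilting modules are add-equivalent. -/
theorem IsSpecialCotilting.inAdd [FiniteDimensional K Γ] [Module.Finite Γ C] [Module.Finite Γ C']
    (H : IsSpecialCotilting Γ K Q C) (H' : IsSpecialCotilting Γ K Q C') : InAdd Γ C' C := by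
  obtain ⟨C₁, C₀, _, _, _, _, f, g, h₀, h₁, hfg⟩ := H.resolves_special
  obtain ⟨C₁', C₀', _, _, _, _, f', g', h₀', h₁', hfg'⟩ := H'.resolves_special
  obtain ⟨N, i, hi⟩ : InCogen Γ C₀ C :=
    ((H.isCotilting.extVanishes.add_right h₁).lifts hfg).inCogen
  obtain ⟨m, a, ha⟩ := exists_left_approximation K (Γ := Γ) C C'
  have ext_add : ∀ (D : Type) [AddCommGroup D] [Module Γ D], InAdd Γ C' D →
      ∀ h : C →ₗ[Γ] D, ∃ k : (Fin m → C') →ₗ[Γ] D, ∀ x, k (a x) = h x := by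
    intro D _ _ ⟨n, j, p, hp⟩ h
    choose k hk using fun l => ha ((LinearMap.proj l).comp (j.comp h))
    refine ⟨p.comp (LinearMap.pi k), fun x => ?_⟩
    have : LinearMap.pi k (a x) = j (h x) := by ext l; exact hk l x
    rw [LinearMap.comp_apply, this]
    exact LinearMap.congr_fun hp (h x)
  have hinj : Injective a := by
    obtain ⟨k, hk⟩ := ext_add _ ((H'.mem_add.trans h₀).pi (ι := Fin N)) i
    exact fun x y hxy => hi (by rw [← hk, ← hk, hxy])
  have hab := isShortExact_mkQ_range hinj
  have hW := (Lifts.of_isShortExact hab hfg' (ext_add _ h₁')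
    (((H'.isCotilting.extVanishes.add_right h₁').lifts hfg').add (InAdd.refl.pi))).inCogen
  obtain ⟨r, hr⟩ := (H.isCotilting.extVanishes_of_inCogen (H.mem_add.trans h₀') hW).splits hab
  exact ⟨m, a, r, hr⟩

/-- The `Q`-special cotilting module attached to an epimorphism `Qⁿ → DΓ` along which all maps
`Q → DΓ` lift. -/
theorem isSpecialCotilting_prod_ker (hQ : Module.Injective Γ Q) {n : ℕ}
    (q : (Fin n → Q) →ₗ[Γ] RegularDual K Γ) (hq : Surjective q) (H : Lifts Q q) :
    IsSpecialCotilting Γ K Q (Q × LinearMap.ker q) := by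
  have hker := isShortExact_ker_subtype hq
  have hD := RegularDual.injective K Γ
  have hQn : Module.Injective Γ (Fin n → Q) := Injective.pi hQ
  have hadd : InAdd Γ (Q × LinearMap.ker q) Q :=
    .of_retract (.inl Γ _ _) (.fst Γ _ _) fun _ => rfl
  have hadd' : InAdd Γ (Q × LinearMap.ker q) (LinearMap.ker q) :=
    .of_retract (.inr Γ _ _) (.snd Γ _ _) fun _ => rfl
  have hE : ExtVanishes Γ (Q × LinearMap.ker q) (LinearMap.ker q) :=
    (H.add (InAdd.refl.prod InAdd.refl.pi)).extVanishes hker hQn hD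
      (LinearMap.prodMap LinearMap.id (LinearMap.ker q).subtype)
      (Injective.prodMap injective_id (Submodule.subtype_injective _))
  refine ⟨⟨⟨Q × (Fin n → Q), RegularDual K Γ, inferInstance, inferInstance, inferInstance,
    inferInstance, LinearMap.prodMap LinearMap.id (LinearMap.ker q).subtype,
    q.comp (LinearMap.snd Γ _ _), Injective.prod hQ hQn, hD,
    Injective.prodMap injective_id (Submodule.subtype_injective _),
    hq.comp LinearMap.snd_surjective, ?_⟩, ?_, ?_⟩, hadd, ?_⟩
  · rintro ⟨x, y⟩
    constructor
    · intro h
      exact ⟨(x, ⟨y, h⟩), rfl⟩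
    · rintro ⟨z, hz⟩
      rw [← hz]
      exact z.2.2
  · intro X _ _ f g hfg
    obtain ⟨k, hk⟩ := hQ.out f hfg.1 (LinearMap.fst Γ _ _)
    obtain ⟨l, hl⟩ := hE _ _ f g hfg (LinearMap.snd Γ _ _)
    exact ⟨k.prod l, LinearMap.ext fun x => Prod.ext (hk x) (hl x)⟩
  · exact ⟨_, _, _, _, _, _, _, q, hadd', hadd.pi, hker⟩
  · exact ⟨_, _, _, _, _, _, _, q, InAdd.refl.pi, hadd', hker⟩

/-- Being `Q`-special cotilting passes to a direct summand with the same `add`. -/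
theorem IsSpecialCotilting.of_retract (H : IsSpecialCotilting Γ K Q C) (i : C' →ₗ[Γ] C)
    (p : C →ₗ[Γ] C') (hp : ∀ x, p (i x) = x) (hC : InAdd Γ C' C) :
    IsSpecialCotilting Γ K Q C' := by
  refine ⟨⟨?_, ?_, ?_⟩, hC.trans H.mem_add, ?_⟩
  · obtain ⟨I₀, I₁, _, _, _, _, f, g, hI₀, hI₁, hfg⟩ := H.isCotilting.idim_le_one
    obtain ⟨V, _, _, u, v, hV, huv⟩ :=
      exists_injective_coresolution_of_retract hfg hI₀ hI₁ i p hp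
    exact ⟨I₀, V, _, _, _, _, u, v, hI₀, hV, huv⟩
  · intro X _ _ f g hfg
    have : InCogen Γ C C' := ⟨1, LinearMap.pi fun _ => i, fun x y hxy => by
      rw [← hp x, ← hp y]; exact congrArg p (congrFun hxy 0)⟩
    exact ((H.isCotilting.extVanishes_of_inCogen .refl this).add_right
      (.of_retract i p hp)).splits hfg
  · obtain ⟨C₁, C₀, _, _, _, _, f, g, h₁, h₀, hfg⟩ := H.isCotilting.resolves
    exact ⟨C₁, C₀, _, _, _, _, f, g, hC.trans h₁, hC.trans h₀, hfg⟩
  · obtain ⟨C₁, C₀, _, _, _, _, f, g, h₀, h₁, hfg⟩ := H.resolves_special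
    exact ⟨C₁, C₀, _, _, _, _, f, g, h₀, hC.trans h₁, hfg⟩

end Cotilting

section Basic

variable {R : Type} [Ring R]

/-- Every module of finite length has a basic direct summand with the same `add`. -/
theorem exists_isBasic_retract (M : Type) [AddCommGroup M] [Module R M]
    [IsArtinian R M] [IsNoetherian R M] :
    ∃ (C : Type) (_ : AddCommGroup C) (_ : Module R C) (i : C →ₗ[R] M) (p : M →ₗ[R] C),
      (∀ x, p (i x) = x) ∧ IsBasic R C ∧ InAdd R C M := by
  induction hl : Module.length R M using WellFoundedLT.induction generalizing M with
  | _ l ih =>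
  by_cases hM : IsBasic R M
  · exact ⟨M, _, _, LinearMap.id, LinearMap.id, fun _ => rfl, hM, .refl⟩
  · simp only [IsBasic, not_forall, not_subsingleton_iff_nontrivial] at hM
    obtain ⟨X, Y, _, _, _, _, ⟨e⟩, hX⟩ := hM
    let i : (X × Y) →ₗ[R] M := e.symm.toLinearMap.comp
      (((LinearMap.inl R X X).comp (LinearMap.fst R X Y)).prod (LinearMap.snd R X Y))
    let p : M →ₗ[R] (X × Y) := ((LinearMap.fst R X X).prodMap LinearMap.id).comp e.toLinearMap
    have hp : ∀ x, p (i x) = x := fun x => by simp [p, i]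
    have hi : Injective i := LeftInverse.injective hp
    have : IsArtinian R (X × Y) := isArtinian_of_injective i hi
    have : IsNoetherian R (X × Y) := isNoetherian_of_injective i hi
    have hlt : Module.length R (X × Y) < l := by
      have hfin : Module.length R (X × Y) ≠ ⊤ := Module.length_ne_top
      rw [← hl, e.length_eq, Module.length_prod, Module.length_prod, Module.length_prod, add_assoc,
        ← Module.length_prod]
      exact ENat.lt_add_left hfin (Module.length_pos (R := R) (M := X))
    obtain ⟨C, _, _, j, r, hr, hC, hadd⟩ := ih _ hlt (X × Y) rfl
    refine ⟨C, _, _, i.comp j, r.comp p, fun x => by simp [hp, hr], hC, hadd.trans ?_⟩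
    have hX : InAdd R (X × Y) X := .of_retract (.inl R _ _) (.fst R _ _) fun _ => rfl
    have hY : InAdd R (X × Y) Y := .of_retract (.inr R _ _) (.snd R _ _) fun _ => rfl
    exact ((hX.prod hX).prod hY).retract e.toLinearMap e.symm.toLinearMap fun m => by simp

/-- An endomorphism of an indecomposable module of finite length is invertible or nilpotent. -/
lemma Indecomposable.isUnit_or_isNilpotent {U : Type} [AddCommGroup U] [Module R U]
    [IsArtinian R U] [IsNoetherian R U] (hU : Indecomposable R U) (φ : Module.End R U) :
    IsUnit φ ∨ IsNilpotent φ := by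
  obtain ⟨n, hn⟩ := Filter.eventually_atTop.1 φ.eventually_isCompl_ker_pow_range_pow
  have hc := (hn (n + 1) (Nat.le_succ n)).symm
  set ψ := φ ^ (n + 1) with hψ
  rcases hU.2 (Submodule.projection _ _ hc) (LinearMap.ext fun x => by simp) with h | h
  · right
    refine ⟨n + 1, ?_⟩
    rw [← hψ]
    ext x
    have := Submodule.projection_apply_left hc ⟨ψ x, x, rfl⟩
    simpa [h] using this.symm
  · left
    have hker : LinearMap.ker ψ = ⊥ := by
      rw [← Submodule.ker_projection hc, h]; simp [LinearMap.ker_id]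
    have : IsUnit ψ := by
      rw [Module.End.isUnit_iff]
      exact IsArtinian.bijective_of_injective_endomorphism ψ (LinearMap.ker_eq_bot.1 hker)
    exact (isUnit_pow_iff (Nat.succ_ne_zero n)).1 this

/-- `U` is a direct summand of `M`. -/
def IsRetract (R : Type) [Ring R] (M U : Type) [AddCommGroup M] [Module R M]
    [AddCommGroup U] [Module R U] : Prop :=
  ∃ (i : U →ₗ[R] M) (p : M →ₗ[R] U), ∀ u, p (i u) = u

lemma IsRetract.exists_equiv {M U : Type} [AddCommGroup M] [Module R M]
    [AddCommGroup U] [Module R U] (h : IsRetract R M U) :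
    ∃ (Y : Type) (_ : AddCommGroup Y) (_ : Module R Y), Nonempty (M ≃ₗ[R] U × Y) := by
  obtain ⟨i, p, hp⟩ := h
  exact ⟨_, _, _, ⟨prodKerEquiv i p hp⟩⟩

lemma IsRetract.trans {M N U : Type} [AddCommGroup M] [Module R M] [AddCommGroup N] [Module R N]
    [AddCommGroup U] [Module R U] (h : IsRetract R M N) (h' : IsRetract R N U) :
    IsRetract R M U := by
  obtain ⟨i, p, hp⟩ := h
  obtain ⟨j, q, hq⟩ := h'
  exact ⟨i.comp j, q.comp p, fun u => by simp [hp, hq]⟩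

lemma IsRetract.of_equiv {M N : Type} [AddCommGroup M] [Module R M] [AddCommGroup N] [Module R N]
    (e : M ≃ₗ[R] N) : IsRetract R M N :=
  ⟨e.symm.toLinearMap, e.toLinearMap, e.apply_symm_apply⟩

section Exchange

variable {U M N : Type} [AddCommGroup U] [Module R U] [IsArtinian R U] [IsNoetherian R U]
  [AddCommGroup M] [Module R M] [AddCommGroup N] [Module R N]

lemma Indecomposable.retract_or_of_prod (hU : Indecomposable R U) (h : IsRetract R (M × N) U) :
    IsRetract R M U ∨ IsRetract R N U := by
  obtain ⟨i, p, hp⟩ := h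
  let φ : Module.End R U := (p.comp (.inl R M N)).comp ((LinearMap.fst R M N).comp i)
  let ψ : Module.End R U := (p.comp (.inr R M N)).comp ((LinearMap.snd R M N).comp i)
  have hadd : φ + ψ = 1 := by
    ext u
    simp [φ, ψ, ← map_add, hp]
  have of_unit : ∀ {L : Type} [AddCommGroup L] [Module R L] (j : U →ₗ[R] L) (q : L →ₗ[R] U),
      IsUnit (q.comp j : Module.End R U) → IsRetract R L U := by
    intro L _ _ j q ⟨v, hv⟩
    refine ⟨j, (↑v⁻¹ : Module.End R U).comp q, fun u => ?_⟩
    have := v.inv_mul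
    rw [hv] at this
    exact LinearMap.congr_fun this u
  rcases hU.isUnit_or_isNilpotent φ with h | h
  · exact .inl (of_unit _ _ h)
  · refine .inr (of_unit ((LinearMap.snd R M N).comp i) (p.comp (.inr R M N)) ?_)
    change IsUnit ψ
    rw [eq_sub_iff_add_eq'.2 hadd]
    exact h.isUnit_one_sub

lemma Indecomposable.retract_of_inAdd (hU : Indecomposable R U) (h : InAdd R M U) :
    IsRetract R M U := by
  obtain ⟨n, i, p, hp⟩ := h
  have hr : IsRetract R (Fin n → M) U := ⟨i, p, LinearMap.congr_fun hp⟩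
  clear hp i p
  induction n with
  | zero =>
    obtain ⟨i, p, hp⟩ := hr
    obtain ⟨x, y, hxy⟩ := hU.1
    exact absurd (by rw [← hp x, ← hp y, Subsingleton.elim (i x) (i y)]) hxy
  | succ n ih =>
    have e := (Fin.consLinearEquiv R (fun _ : Fin (n + 1) => M)).symm
    exact (hU.retract_or_of_prod ((IsRetract.of_equiv e.symm).trans hr)).elim id ih

variable (R M) in
lemma exists_indecomposable_retract [IsArtinian R M] [IsNoetherian R M] [Nontrivial M] :
    ∃ (U : Type) (_ : AddCommGroup U) (_ : Module R U), IsArtinian R U ∧ IsNoetherian R U ∧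
      Indecomposable R U ∧ IsRetract R M U := by
  induction hl : Module.length R M using WellFoundedLT.induction generalizing M with
  | _ l ih =>
  by_cases hM : Indecomposable R M
  · exact ⟨M, _, _, ‹_›, ‹_›, hM, LinearMap.id, LinearMap.id, fun _ => rfl⟩
  · simp only [Indecomposable, not_and, not_forall, not_or] at hM
    obtain ⟨e, he, h0, h1⟩ := hM ‹_›
    have hfix : ∀ x, e (e x) = e x := LinearMap.congr_fun he
    have hne : LinearMap.range e < ⊤ := by
      refine lt_top_iff_ne_top.2 fun h => h1 (LinearMap.ext fun x => ?_)
      obtain ⟨y, rfl⟩ := LinearMap.range_eq_top.1 h x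
      exact hfix y
    have : Nontrivial (LinearMap.range e) := by
      rw [Submodule.nontrivial_iff_ne_bot]
      exact fun h => h0 (LinearMap.range_eq_bot.1 h)
    obtain ⟨U, _, _, hA, hN, hU, hr⟩ :=
      ih _ (hl ▸ Submodule.length_lt hne.ne) (LinearMap.range e) rfl
    refine ⟨U, _, _, hA, hN, hU, IsRetract.trans
      ⟨(LinearMap.range e).subtype, e.rangeRestrict, ?_⟩ hr⟩
    rintro ⟨_, y, rfl⟩
    exact Subtype.ext (hfix y)

end Exchange

/-- An indecomposable direct summand of the basic module `X × Y` lying in `Y` does not lie in `X`;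
hence if `X × Y ∈ add (X × Y')`, it is a direct summand of `Y'`. -/
lemma IsBasic.isRetract_complement {D D' X Y Y' U : Type} [AddCommGroup D] [Module R D]
    [AddCommGroup D'] [Module R D'] [AddCommGroup X] [Module R X] [AddCommGroup Y] [Module R Y]
    [AddCommGroup Y'] [Module R Y'] [AddCommGroup U] [Module R U] [IsArtinian R U]
    [IsNoetherian R U] (hD : IsBasic R D) (h : InAdd R D' D) (e : D ≃ₗ[R] X × Y)
    (e' : D' ≃ₗ[R] X × Y') (hU : Indecomposable R U) (hr : IsRetract R Y U) :
    IsRetract R Y' U := by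
  obtain ⟨i, p, hp⟩ := ((IsRetract.of_equiv e).trans
    ⟨.inr R _ _, .snd R _ _, fun _ => rfl⟩).trans hr
  refine (hU.retract_or_of_prod ((IsRetract.of_equiv e'.symm).trans
    (hU.retract_of_inAdd (h.retract i p hp)))).resolve_left fun hX => ?_
  obtain ⟨X', _, _, ⟨f⟩⟩ := hX.exists_equiv
  obtain ⟨Y', _, _, ⟨g⟩⟩ := hr.exists_equiv
  have := hU.1
  exact not_subsingleton U (hD U (X' × Y')
    ⟨e.trans ((f.prodCongr g).trans (LinearEquiv.prodProdProdComm R U X' U Y'))⟩)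

/-- Basic modules of finite length with the same `add` are isomorphic; a common direct factor may
be split off. -/
lemma IsBasic.nonempty_equiv_of_prod {C C' : Type} [AddCommGroup C] [Module R C] [AddCommGroup C']
    [Module R C'] (hC : IsBasic R C) (hC' : IsBasic R C') (h : InAdd R C' C) (h' : InAdd R C C')
    (X Y Y' : Type) [AddCommGroup X] [Module R X] [AddCommGroup Y] [Module R Y]
    [AddCommGroup Y'] [Module R Y'] [IsArtinian R Y] [IsNoetherian R Y] [IsArtinian R Y']
    [IsNoetherian R Y'] (e : C ≃ₗ[R] X × Y) (e' : C' ≃ₗ[R] X × Y') :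
    Nonempty (C ≃ₗ[R] C') := by
  induction hl : Module.length R Y using WellFoundedLT.induction generalizing X Y Y' with
  | _ l ih =>
  rcases subsingleton_or_nontrivial Y with hY | hY
  · rcases subsingleton_or_nontrivial Y' with hY' | hY'
    · have : Unique Y := uniqueOfSubsingleton 0
      have : Unique Y' := uniqueOfSubsingleton 0
      exact ⟨e.trans (LinearEquiv.prodUnique.trans (LinearEquiv.prodUnique.symm.trans e'.symm))⟩
    · obtain ⟨U, _, _, _, _, hU, hr⟩ := exists_indecomposable_retract R Y'
      obtain ⟨i, p, hp⟩ := hC'.isRetract_complement h' e' e hU hr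
      have := hU.1
      exact (not_subsingleton U (LeftInverse.injective hp).subsingleton).elim
  · obtain ⟨U, _, _, _, _, hU, hr⟩ := exists_indecomposable_retract R Y
    obtain ⟨Z, _, _, ⟨f⟩⟩ := hr.exists_equiv
    obtain ⟨Z', _, _, ⟨f'⟩⟩ := (hC.isRetract_complement h e e' hU hr).exists_equiv
    have hZ : Injective (f.symm.toLinearMap.comp (.inr R U Z)) :=
      f.symm.injective.comp LinearMap.inr_injective
    have hZ' : Injective (f'.symm.toLinearMap.comp (.inr R U Z')) :=
      f'.symm.injective.comp LinearMap.inr_injective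
    have : IsArtinian R Z := isArtinian_of_injective _ hZ
    have : IsNoetherian R Z := isNoetherian_of_injective _ hZ
    have : IsArtinian R Z' := isArtinian_of_injective _ hZ'
    have : IsNoetherian R Z' := isNoetherian_of_injective _ hZ'
    have := hU.1
    refine ih (Module.length R Z) ?_ (X × U) Z Z'
      (e.trans (((LinearEquiv.refl R X).prodCongr f).trans (LinearEquiv.prodAssoc R X U Z).symm))
      (e'.trans (((LinearEquiv.refl R X).prodCongr f').trans
        (LinearEquiv.prodAssoc R X U Z').symm)) rfl
    rw [← hl, f.length_eq, Module.length_prod]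
    exact ENat.lt_add_left Module.length_ne_top (Module.length_pos (R := R) (M := U))

/-- Basic modules of finite length with the same `add` are isomorphic. -/
theorem IsBasic.nonempty_equiv {C C' : Type} [AddCommGroup C] [Module R C] [AddCommGroup C']
    [Module R C'] [IsArtinian R C] [IsNoetherian R C] [IsArtinian R C'] [IsNoetherian R C']
    (hC : IsBasic R C) (hC' : IsBasic R C') (h : InAdd R C' C) (h' : InAdd R C C') :
    Nonempty (C ≃ₗ[R] C') :=
  hC.nonempty_equiv_of_prod hC' h h' Unit C C' LinearEquiv.uniqueProd.symm
    LinearEquiv.uniqueProd.symm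

end Basic

end GenFinitePaper

namespace GenFinitePaper

open Function MulOpposite

namespace ModuleDual

variable {K A E : Type} [Field K] [Ring A] [Algebra K A] [AddCommGroup E] [Module A E]
  [Module K E] [IsScalarTower K A E]

instance : CoeFun (ModuleDual K A E) fun _ => E → K :=
  ⟨fun f => DFunLike.coe (F := E →ₗ[K] K) f⟩

lemma ext {f g : ModuleDual K A E} (h : ∀ x, f x = g x) : f = g :=
  LinearMap.ext (f := show E →ₗ[K] K from f) h

lemma map_add (f : ModuleDual K A E) (x y : E) : f (x + y) = f x + f y :=
  LinearMap.map_add (show E →ₗ[K] K from f) x y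

lemma map_smul (f : ModuleDual K A E) (c : K) (x : E) : f (c • x) = c * f x :=
  LinearMap.map_smul (show E →ₗ[K] K from f) c x

lemma map_sum (f : ModuleDual K A E) {ι : Type} (s : Finset ι) (x : ι → E) :
    f (∑ j ∈ s, x j) = ∑ j ∈ s, f (x j) :=
  _root_.map_sum (show E →ₗ[K] K from f) x s

/-- Evaluation at an element of `E`. -/
def evalAt (x : E) : ModuleDual K A E →ₗ[K] K where
  toFun f := f x
  map_add' _ _ := rfl
  map_smul' _ _ := rfl

lemma eq_of_forall [FiniteDimensional K E] {x y : E}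
    (h : ∀ f : ModuleDual K A E, f x = f y) : x = y :=
  (Module.evalEquiv K E).injective (LinearMap.ext h)

instance : IsScalarTower K (Module.End A E)ᵐᵒᵖ (ModuleDual K A E) := by
  refine ⟨fun c s f => ext fun x => ?_⟩
  change f (c • s.unop x) = c * f (s.unop x)
  rw [map_smul]

instance [FiniteDimensional K E] : Module.Finite K (ModuleDual K A E) :=
  inferInstanceAs (Module.Finite K (E →ₗ[K] K))

/-- Linear forms on `D E` are given by evaluation at elements of `E`. -/
lemma exists_eval [FiniteDimensional K E] (l : ModuleDual K A E →ₗ[K] K) :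
    ∃ x : E, ∀ f, l f = f x := by
  obtain ⟨x, hx⟩ := (Module.evalEquiv K E).surjective (show Module.Dual K (Module.Dual K E) from l)
  exact ⟨x, fun f => (LinearMap.congr_fun hx f).symm⟩

end ModuleDual

section

variable {K A E : Type} [Field K] [Ring A] [Algebra K A] [AddCommGroup E] [Module A E]
  [Module K E] [IsScalarTower K A E]

/-- Evaluation of elements of `D Γ`. -/
def RegularDual.evalAt (K : Type) [Field K] {Γ : Type} [Ring Γ] [Algebra K Γ] (s : Γ) :
    RegularDual K Γ →+ K where
  toFun F := F s
  map_zero' := rfl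
  map_add' _ _ := rfl

lemma finite_end_op [FiniteDimensional K E] :
    FiniteDimensional K (Module.End A E)ᵐᵒᵖ := by
  have : Module.Finite K (E →ₗ[A] E) :=
    .of_injective (LinearMap.restrictScalarsₗ K A E E K) (LinearMap.restrictScalars_injective K)
  have : Module.Finite K (Module.End A E) := this
  exact .equiv (opLinearEquiv K)

/-- The endomorphism `y ↦ p y • x` of `E`. -/
def rankOne (p : E →ₗ[A] A) (x : E) : Module.End A E := (LinearMap.toSpanSingleton A E x).comp p

lemma rankOne_apply (p : E →ₗ[A] A) (x y : E) : rankOne p x y = p y • x := rfl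

lemma IsGenerator.exists_sum_eq_one (hE : IsGenerator A E) :
    ∃ (n : ℕ) (e : Fin n → E) (p : Fin n → E →ₗ[A] A), ∑ j, p j (e j) = 1 := by
  obtain ⟨n, i, p, hp⟩ := hE
  refine ⟨n, i 1, fun j => p.comp (LinearMap.single A (fun _ => E) j), ?_⟩
  have := LinearMap.congr_fun hp 1
  simp only [LinearMap.comp_apply, LinearMap.id_apply] at this
  rw [← Finset.univ_sum_single (i 1), map_sum] at this
  exact this

lemma IsGenerator.injective_moduleDual (hE : IsGenerator A E) :
    Module.Injective (Module.End A E)ᵐᵒᵖ (ModuleDual K A E) := by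
  obtain ⟨n, e, p, h⟩ := hE.exists_sum_eq_one
  let i : ModuleDual K A E →ₗ[(Module.End A E)ᵐᵒᵖ] (Fin n → RegularDual K (Module.End A E)ᵐᵒᵖ) :=
    LinearMap.pi fun j => RegularDual.ofForm K (Module.End A E)ᵐᵒᵖ (ModuleDual.evalAt (e j))
  let r₀ (F : Fin n → RegularDual K (Module.End A E)ᵐᵒᵖ) : E →ₗ[K] K :=
    { toFun x := ∑ j, F j (op (rankOne (p j) x))
      map_add' x y := by
        rw [← Finset.sum_add_distrib]
        refine Finset.sum_congr rfl fun j _ => ?_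
        rw [← LinearMap.map_add]
        congr 2
        ext y
        simp [rankOne_apply]
      map_smul' c x := by
        rw [Finset.smul_sum]
        refine Finset.sum_congr rfl fun j _ => ?_
        rw [← LinearMap.map_smul]
        congr 2
        ext y
        exact smul_comm _ _ _ }
  let r : (Fin n → RegularDual K (Module.End A E)ᵐᵒᵖ) →ₗ[(Module.End A E)ᵐᵒᵖ] ModuleDual K A E :=
    { toFun F := r₀ F
      map_add' F G := by
        refine ModuleDual.ext fun x => ?_
        change ∑ j, (F j (op (rankOne (p j) x)) + G j (op (rankOne (p j) x))) =
          ∑ j, F j (op (rankOne (p j) x)) + ∑ j, G j (op (rankOne (p j) x))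
        exact Finset.sum_add_distrib
      map_smul' s F := by
        refine ModuleDual.ext fun x => ?_
        change ∑ j, F j (op (rankOne (p j) x) * s) = ∑ j, F j (op (rankOne (p j) (s.unop x)))
        refine Finset.sum_congr rfl fun j _ => ?_
        congr 1
        apply unop_injective
        ext y
        simp [rankOne_apply] }
  refine Injective.retract (Injective.pi (RegularDual.injective K (Module.End A E)ᵐᵒᵖ)) i r
    fun f => ?_
  refine ModuleDual.ext fun x => ?_
  change ∑ j, f (p j (e j) • x) = f x
  rw [← ModuleDual.map_sum, ← Finset.sum_smul, h, one_smul]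

/-- An epimorphism from a power of `D E` to `D Γ` along which maps from `D E` lift. -/
lemma exists_surjective_lifts [FiniteDimensional K E] :
    ∃ (n : ℕ) (q : (Fin n → ModuleDual K A E) →ₗ[(Module.End A E)ᵐᵒᵖ]
      RegularDual K (Module.End A E)ᵐᵒᵖ), Surjective q ∧ Lifts (ModuleDual K A E) q := by
  let b := Module.finBasis K E
  let q : (Fin (Module.finrank K E) → ModuleDual K A E) →ₗ[(Module.End A E)ᵐᵒᵖ]
      RegularDual K (Module.End A E)ᵐᵒᵖ :=
    ∑ j, (RegularDual.ofForm K (Module.End A E)ᵐᵒᵖ (ModuleDual.evalAt (b j))).comp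
      (LinearMap.proj j)
  have hq : ∀ F (s : (Module.End A E)ᵐᵒᵖ), q F s = ∑ j, F j (s.unop (b j)) := fun F s => by
    change RegularDual.evalAt K s (q F) = _
    simp only [q, LinearMap.sum_apply, _root_.map_sum]
    rfl
  refine ⟨_, q, fun F => ?_, fun h => ?_⟩
  · let v : (Module.End A E)ᵐᵒᵖ →ₗ[K] (Fin (Module.finrank K E) → E) :=
      { toFun s j := s.unop (b j)
        map_add' s t := rfl
        map_smul' c s := rfl }
    have hv : Injective v := fun s t hst => by
      apply unop_injective
      refine LinearMap.restrictScalars_injective K (b.ext fun j => congrFun hst j)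
    obtain ⟨u, hu⟩ := v.exists_leftInverse_of_injective (LinearMap.ker_eq_bot.2 hv)
    let G : (Fin (Module.finrank K E) → E) →ₗ[K] K :=
      (show (Module.End A E)ᵐᵒᵖ →ₗ[K] K from F).comp u
    let f (j) : ModuleDual K A E := G.comp (LinearMap.single K (fun _ => E) j)
    refine ⟨f, LinearMap.ext fun s => (hq f s).trans ?_⟩
    change ∑ j, G (Pi.single j (v s j)) = _
    rw [← map_sum, Finset.univ_sum_single]
    exact congrArg (show (Module.End A E)ᵐᵒᵖ →ₗ[K] K from F) (LinearMap.congr_fun hu s)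
  · obtain ⟨x, hx⟩ := ModuleDual.exists_eval (RegularDual.toForm K (Module.End A E)ᵐᵒᵖ h)
    refine ⟨LinearMap.pi fun j =>
      { toFun f := b.repr x j • f
        map_add' f g := smul_add _ _ _
        map_smul' s f := (smul_comm _ _ _) }, fun f => ?_⟩
    refine LinearMap.ext fun s => ?_
    rw [hq, RegularDual.apply_eq K (Module.End A E)ᵐᵒᵖ h]
    change ∑ j, b.repr x j * f (s.unop (b j)) = RegularDual.toForm K (Module.End A E)ᵐᵒᵖ h (s • f)
    rw [hx]
    change _ = f (s.unop x)
    conv_rhs => rw [← b.sum_repr x]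
    simp only [← ModuleDual.map_smul, ← ModuleDual.map_sum]
    congr 1
    rw [map_sum]
    refine Finset.sum_congr rfl fun j _ => ?_
    exact (LinearMap.map_smul (s.unop.restrictScalars K) _ _).symm

/-- Scalars from `A` act by endomorphisms on `D E`. -/
def toEndModuleDual : A →+* (Module.End (Module.End A E)ᵐᵒᵖ (ModuleDual K A E))ᵐᵒᵖ where
  toFun a := op
    { toFun f := (show E →ₗ[K] K from f).comp (Algebra.lsmul K K E a)
      map_add' _ _ := rfl
      map_smul' s f := ModuleDual.ext fun x => congrArg f (s.unop.map_smul a x) }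
  map_one' := unop_injective (LinearMap.ext fun f => ModuleDual.ext fun x =>
    congrArg f (one_smul A x))
  map_mul' a b := unop_injective (LinearMap.ext fun f => ModuleDual.ext fun x =>
    congrArg f (mul_smul a b x))
  map_zero' := unop_injective (LinearMap.ext fun f => ModuleDual.ext fun x =>
    (congrArg f (zero_smul A x)).trans (LinearMap.map_zero (show E →ₗ[K] K from f)))
  map_add' a b := unop_injective (LinearMap.ext fun f => ModuleDual.ext fun x =>
    (congrArg f (add_smul a b x)).trans (f.map_add _ _))

lemma toEndModuleDual_apply (a : A) (f : ModuleDual K A E) (x : E) :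
    ((toEndModuleDual (K := K) (E := E) a).unop f) x = f (a • x) := rfl

lemma IsGenerator.bijective_toEndModuleDual [FiniteDimensional K E] (hE : IsGenerator A E) :
    Bijective (toEndModuleDual (K := K) (A := A) (E := E)) := by
  obtain ⟨n, e, p, h⟩ := hE.exists_sum_eq_one
  constructor
  · rw [injective_iff_map_eq_zero]
    intro a ha
    have ha' : ∀ x : E, a • x = 0 := fun x => ModuleDual.eq_of_forall (K := K) (A := A) fun f => by
      rw [← toEndModuleDual_apply, ha]
      exact (LinearMap.map_zero (show E →ₗ[K] K from f)).symm
    rw [← mul_one a, ← h, Finset.mul_sum]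
    refine Finset.sum_eq_zero fun j _ => ?_
    rw [← smul_eq_mul, ← map_smul, ha', map_zero]
  · intro Φ
    have hK : ∀ (c : K) f, Φ.unop (c • f) = c • Φ.unop f := fun c f => by
      rw [← algebraMap_smul (Module.End A E)ᵐᵒᵖ c f, map_smul, algebraMap_smul]
    choose φ hφ using fun x : E => ModuleDual.exists_eval (K := K) (A := A) (E := E)
      { toFun f := (Φ.unop f) x
        map_add' f g := by rw [map_add]; rfl
        map_smul' c f := by rw [hK]; rfl }
    change ∀ x f, (Φ.unop f) x = f (φ x) at hφ
    have hs : ∀ (s : Module.End A E) x, φ (s x) = s (φ x) := fun s x =>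
      ModuleDual.eq_of_forall (K := K) (A := A) fun f => by
        rw [← hφ]
        change (op s • Φ.unop f) x = (op s • f) (φ x)
        rw [← map_smul, hφ]
    have hadd : ∀ x y, φ (x + y) = φ x + φ y := fun x y =>
      ModuleDual.eq_of_forall (K := K) (A := A) fun f => by
        rw [← hφ, ModuleDual.map_add, ModuleDual.map_add, hφ, hφ]
    refine ⟨∑ j, p j (φ (e j)), unop_injective (LinearMap.ext fun f => ModuleDual.ext fun x => ?_)⟩
    rw [toEndModuleDual_apply, hφ]
    congr 1
    have hx : x = ∑ j, rankOne (p j) x (e j) := by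
      simp only [rankOne_apply, ← Finset.sum_smul, h, one_smul]
    conv_rhs => rw [hx]
    rw [show φ (∑ j, rankOne (p j) x (e j)) = ∑ j, φ (rankOne (p j) x (e j)) from
      map_sum (AddMonoidHom.mk' φ hadd) _ _, Finset.sum_smul]
    simp only [hs]
    rfl

end

end GenFinitePaper

namespace GenFinitePaper

/-- Let `A` be a finite-dimensional `K`-algebra, `E` a finite-dimensional
`A`-module which is a generator, and `Γ = End_A(E)ᵒᵖ`.  Then `Q = D E` is an injective
`Γ`-module, there exists a `Q`-special cotilting `Γ`-module, which is unique up to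
add-equivalence (so there is a unique basic `Q`-special cotilting module `C^Q`), and
`End_Γ(Q)ᵒᵖ ≅ A`. -/
theorem generator_special_cotilting
    (K A : Type) [Field K] [Ring A] [Algebra K A] [FiniteDimensional K A]
    (E : Type) [AddCommGroup E] [Module A E] [Module K E] [IsScalarTower K A E]
    [FiniteDimensional K E]
    (hE : IsGenerator A E) :
    -- `Q = D E` is an injective `Γ`-module
    Module.Injective (Module.End A E)ᵐᵒᵖ (ModuleDual K A E) ∧
    -- there is a basic `Q`-special cotilting module, unique up to add-equivalence
    (∃ (C : Type) (_ : AddCommGroup C) (_ : Module (Module.End A E)ᵐᵒᵖ C),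
      Module.Finite (Module.End A E)ᵐᵒᵖ C ∧ IsBasic (Module.End A E)ᵐᵒᵖ C ∧
      IsSpecialCotilting (Module.End A E)ᵐᵒᵖ K (ModuleDual K A E) C ∧
      ∀ (C' : Type) (_ : AddCommGroup C') (_ : Module (Module.End A E)ᵐᵒᵖ C'),
        Module.Finite (Module.End A E)ᵐᵒᵖ C' →
        IsSpecialCotilting (Module.End A E)ᵐᵒᵖ K (ModuleDual K A E) C' →
        (∀ (M : Type) [AddCommGroup M] [Module (Module.End A E)ᵐᵒᵖ M],
            (InAdd (Module.End A E)ᵐᵒᵖ C M ↔ InAdd (Module.End A E)ᵐᵒᵖ C' M)) ∧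
          (IsBasic (Module.End A E)ᵐᵒᵖ C' → Nonempty (C ≃ₗ[(Module.End A E)ᵐᵒᵖ] C'))) ∧
    -- `End_Γ(Q)ᵒᵖ ≅ A`
    Nonempty ((Module.End (Module.End A E)ᵐᵒᵖ (ModuleDual K A E))ᵐᵒᵖ ≃+* A) := by
  have := finite_end_op (K := K) (A := A) (E := E)
  have hart : IsArtinianRing (Module.End A E)ᵐᵒᵖ := .of_finite K _
  have hnoe : IsNoetherianRing (Module.End A E)ᵐᵒᵖ := .of_finite K _
  have hQ := hE.injective_moduleDual (K := K)
  have : Module.Finite (Module.End A E)ᵐᵒᵖ (ModuleDual K A E) :=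
    .of_restrictScalars_finite K _ _
  obtain ⟨n, q, hq, hl⟩ := exists_surjective_lifts (K := K) (A := A) (E := E)
  obtain ⟨C, _, _, i, p, hp, hC, hadd⟩ :=
    exists_isBasic_retract (R := (Module.End A E)ᵐᵒᵖ) (ModuleDual K A E × LinearMap.ker q)
  have : Module.Finite (Module.End A E)ᵐᵒᵖ C :=
    .of_surjective p (Function.RightInverse.surjective hp)
  have hS := (isSpecialCotilting_prod_ker hQ q hq hl).of_retract i p hp hadd
  refine ⟨hQ, ⟨C, _, _, ‹_›, hC, hS, fun C' _ _ _ hS' => ⟨fun M _ _ => ?_, fun hC' => ?_⟩⟩,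
    ⟨(RingEquiv.ofBijective _ hE.bijective_toEndModuleDual).symm⟩⟩
  · exact ⟨(hS.inAdd hS').trans, (hS'.inAdd hS).trans⟩
  · exact hC.nonempty_equiv hC' (hS.inAdd hS') (hS'.inAdd hS)

end GenFinitePaper
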